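/- arXiv:2405.13802 — 14 statements merged into one kernel-verified Lean document; each statement's English description precedes it below -/
import Mathlib

section
/- Let H be a Heyting algebra and let a, d be elements of H. The following are equivalent: (1) a ≤ d and d ⇨ a = a (i.e. d is dense over a); (2) d ⇨ a ≤ d; (3) there exists h ∈ H with d = h ⊔ (h ⇨ a). -/
/-- Characterizations of an element `d` being dense over `a` in a Heyting algebra. -/
theorem stmt_1 {H : Type*} [HeytingAlgebra H] (a d : H) :
    List.TFAE [a ≤ d ∧ d ⇨ a = a, d ⇨ a ≤ d, ∃ h : H, d = h ⊔ (h ⇨ a)] := by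
  tfae_have 1 → 2 := fun ⟨hle, heq⟩ => heq.trans_le hle
  tfae_have 2 → 3 := fun hle => ⟨d, (sup_eq_left.2 hle).symm⟩
  tfae_have 3 → 1 := by
    rintro ⟨h, rfl⟩
    refine ⟨le_himp.trans le_sup_right, ?_⟩
    rw [sup_himp_distrib, inf_himp, inf_eq_right]
    exact le_himp
  tfae_finish
end

section
/- Let H be a Heyting algebra. There exists a unary operation Δ : H → H satisfying the identities x ≤ Δx, (Δx) ⇨ x = x, and Δx ≤ y ⊔ (y ⇨ x) for all x, y ∈ H, if and only if for every a ∈ H the filter D_a(H) has a least element; moreover, in that case Δ(a) is necessarily the least element of D_a(H) for every a ∈ H. -/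
theorem sup_himp_himp_self {H : Type*} [HeytingAlgebra H] (x y : H) :
    (y ⊔ (y ⇨ x)) ⇨ x = x := by
  refine le_antisymm ?_ le_himp
  rw [sup_himp_distrib]
  exact inf_himp_le

theorem isLeast_dense_of_le_sup_himp {H : Type*} [HeytingAlgebra H] {a m : H} (h₁ : a ≤ m)
    (h₂ : m ⇨ a = a) (h₃ : ∀ y, m ≤ y ⊔ (y ⇨ a)) :
    IsLeast {d : H | a ≤ d ∧ d ⇨ a = a} m := by
  refine ⟨⟨h₁, h₂⟩, fun d ⟨had, hd⟩ => ?_⟩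
  simpa [hd, had] using h₃ d


/-- A Heyting algebra admits an operation `Δ` satisfying the KM-identities iff for
every `a` the filter `D_a(H)` of elements dense over `a` has a least element;
moreover any such `Δ a` is necessarily that least element. -/
theorem stmt_3 {H : Type*} [HeytingAlgebra H] :
    ((∃ Δ : H → H, (∀ x, x ≤ Δ x) ∧ (∀ x, Δ x ⇨ x = x) ∧ (∀ x y, Δ x ≤ y ⊔ (y ⇨ x))) ↔
      ∀ a : H, ∃ m, IsLeast {d : H | a ≤ d ∧ d ⇨ a = a} m) ∧
    (∀ Δ : H → H, (∀ x, x ≤ Δ x) → (∀ x, Δ x ⇨ x = x) → (∀ x y, Δ x ≤ y ⊔ (y ⇨ x)) →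
      ∀ a : H, IsLeast {d : H | a ≤ d ∧ d ⇨ a = a} (Δ a)) := by
  refine ⟨⟨fun ⟨Δ, h₁, h₂, h₃⟩ a =>
    ⟨Δ a, isLeast_dense_of_le_sup_himp (h₁ a) (h₂ a) (h₃ a)⟩, fun h => ?_⟩,
    fun Δ h₁ h₂ h₃ a => isLeast_dense_of_le_sup_himp (h₁ a) (h₂ a) (h₃ a)⟩
  choose Δ hΔ using h
  exact ⟨Δ, fun x => (hΔ x).1.1, fun x => (hΔ x).1.2, fun x y =>
    (hΔ x).2 ⟨le_himp.trans le_sup_right, sup_himp_himp_self x y⟩⟩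
end

section
/- Let H be a Heyting algebra and x, h, a ∈ H. Then x ⇨ ((h ⇨ a) ⇨ h) = ((x ⇨ h) ⇨ a) ⇨ (x ⇨ h). -/
theorem himp_himp_inf_self {H : Type*} [HeytingAlgebra H] (x h a : H) :
    ((x ⇨ h) ⇨ a) ⊓ x = (h ⇨ a) ⊓ x := by
  apply le_antisymm
  · exact inf_le_inf_right x (himp_le_himp_right le_himp)
  · refine le_inf ?_ inf_le_right
    rw [le_himp_iff, inf_assoc, inf_himp, inf_comm x h, ← inf_assoc]
    exact inf_le_left.trans himp_inf_le

theorem stmt_4 {H : Type*} [HeytingAlgebra H] (x h a : H) :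
    x ⇨ ((h ⇨ a) ⇨ h) = ((x ⇨ h) ⇨ a) ⇨ (x ⇨ h) := by
  rw [himp_left_comm x, himp_himp, himp_himp, himp_himp_inf_self]
end

section
/- Let H be a Heyting algebra and x, h, a ∈ H. Then x ⇨ h belongs to D_a(H) (that is, a ≤ x ⇨ h and (x ⇨ h) ⇨ a = a) if and only if x ≤ (h ⇨ a) ⇨ h. -/
/-- `x ⇨ h` is dense over `a` if and only if `x ≤ (h ⇨ a) ⇨ h`. -/
theorem stmt_5 {H : Type*} [HeytingAlgebra H] (x h a : H) :
    (a ≤ x ⇨ h ∧ (x ⇨ h) ⇨ a = a) ↔ x ≤ (h ⇨ a) ⇨ h := by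
  constructor
  · rintro ⟨ha, hd⟩
    have hya : x ⊓ (h ⇨ a) ≤ a := by
      rw [← hd, le_himp_iff, hd, inf_right_comm, inf_himp, inf_assoc, inf_himp]
      exact inf_le_right.trans inf_le_right
    rw [le_himp_iff]
    calc x ⊓ (h ⇨ a) ≤ x ⊓ (x ⇨ h) := le_inf inf_le_left (hya.trans ha)
      _ ≤ h := inf_himp_le
  · intro hx
    have hle : h ⇨ a ≤ x ⇨ h := le_himp_comm.mp hx
    refine ⟨le_himp.trans hle, le_antisymm ?_ le_himp⟩
    have hu : (x ⇨ h) ⇨ a ≤ x ⇨ h := (himp_le_himp_right le_himp).trans hle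
    calc (x ⇨ h) ⇨ a ≤ (x ⇨ h) ⊓ ((x ⇨ h) ⇨ a) := le_inf hu le_rfl
      _ ≤ a := inf_himp_le
end

section
/- Let H be a Heyting algebra and a, a' ∈ H. Then a' is the least element of D_a(H) if and only if (a ⇨ h) ⊓ ((h ⇨ a) ⇨ a) = a' ⇨ h holds for every h ∈ H. -/
theorem le_himp_and_himp_himp_eq {H : Type*} [HeytingAlgebra H] {a h x : H}
    (h₁ : x ≤ a ⇨ h) (h₂ : x ≤ (h ⇨ a) ⇨ a) :
    a ≤ x ⇨ h ∧ (x ⇨ h) ⇨ a = a := by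
  refine ⟨le_himp_comm.1 h₁, le_antisymm ?_ le_himp⟩
  have hya : ((x ⇨ h) ⇨ a) ⊓ x ≤ a :=
    (inf_le_inf (himp_le_himp_right le_himp) h₂).trans inf_himp_le
  have hyh : (x ⇨ h) ⇨ a ≤ x ⇨ h :=
    le_himp_iff.2 ((le_inf hya (inf_le_right.trans h₁)).trans inf_himp_le)
  exact (le_inf hyh le_rfl).trans inf_himp_le

/-- `a'` is the least element of `D_a(H)` iff
`(a ⇨ h) ⊓ ((h ⇨ a) ⇨ a) = a' ⇨ h` for all `h`. -/
theorem stmt_8 {H : Type*} [HeytingAlgebra H] (a a' : H) :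
    IsLeast {d : H | a ≤ d ∧ d ⇨ a = a} a' ↔
      ∀ h : H, (a ⇨ h) ⊓ ((h ⇨ a) ⇨ a) = a' ⇨ h := by
  constructor
  · rintro ⟨⟨ha, hd⟩, hmin⟩ h
    apply le_antisymm
    · exact le_himp_comm.1 (hmin (le_himp_and_himp_himp_eq inf_le_left inf_le_right))
    · refine le_inf (himp_le_himp_right ha) (le_himp_iff.2 ?_)
      exact (himp_triangle a' h a).trans_eq hd
  · intro hH
    have key := hH a'
    rw [himp_self, inf_eq_top_iff, himp_eq_top_iff, himp_eq_top_iff] at key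
    refine ⟨⟨key.1, le_antisymm key.2 le_himp⟩, ?_⟩
    rintro d ⟨had, hd⟩
    rw [← himp_eq_top_iff, ← hH d, hd, himp_self, himp_eq_top_iff.2 had, inf_top_eq]
end

section
/- Let H be a Heyting algebra, a ∈ H, and let H⟨ι⟩ ⊆ H^{D_a(H)} be the subalgebra generated by the constant functions and the inclusion ι : D_a(H) ↪ H. Then for every η ∈ H⟨ι⟩ and every d ∈ D_a(H), one has d ⊓ η(d) = d ⊓ η(1), where 1 is the top element of H (which lies in D_a(H)). -/
/-- `H⟨ι⟩`: the smallest subset of the product Heyting algebra `H^{D_a(H)}`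
(functions `D_a(H) → H` with pointwise operations) containing all constant
functions and the inclusion `ι : D_a(H) ↪ H`, closed under pointwise `⊓`, `⊔`, `⇨`. -/
inductive HIota {H : Type*} [HeytingAlgebra H] (a : H) :
    ({d : H // a ≤ d ∧ d ⇨ a = a} → H) → Prop
  | iota : HIota a (fun d => d.val)
  | const (c : H) : HIota a (fun _ => c)
  | inf {f g} : HIota a f → HIota a g → HIota a (f ⊓ g)
  | sup {f g} : HIota a f → HIota a g → HIota a (f ⊔ g)
  | himp {f g} : HIota a f → HIota a g → HIota a (f ⇨ g)


theorem inf_himp_eq_inf_himp_inf_inf {H : Type*} [HeytingAlgebra H] (d x y : H) :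
    d ⊓ (x ⇨ y) = d ⊓ (d ⊓ x ⇨ d ⊓ y) := by
  apply le_antisymm
  · refine le_inf inf_le_left (le_himp_iff.2 (le_inf (inf_le_left.trans inf_le_left) ?_))
    exact (inf_le_inf inf_le_right inf_le_right).trans himp_inf_le
  · refine le_inf inf_le_left (le_himp_iff.2 ?_)
    calc d ⊓ (d ⊓ x ⇨ d ⊓ y) ⊓ x = (d ⊓ x ⇨ d ⊓ y) ⊓ (d ⊓ x) := by ac_rfl
      _ ≤ d ⊓ y := himp_inf_le
      _ ≤ y := inf_le_right

/-- For every `η ∈ H⟨ι⟩` and every `d ∈ D_a(H)`, one has `d ⊓ η d = d ⊓ η 1`,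
where `1 = ⊤` is the top element (which is dense over `a`). -/
theorem stmt_11 {H : Type*} [HeytingAlgebra H] (a : H)
    (η : {d : H // a ≤ d ∧ d ⇨ a = a} → H) (hη : HIota a η)
    (d : {d : H // a ≤ d ∧ d ⇨ a = a}) :
    d.val ⊓ η d = d.val ⊓ η ⟨⊤, le_top, top_himp⟩ := by
  induction hη with
  | iota => simp
  | const c => rfl
  | inf _ _ hf hg => rw [Pi.inf_apply, Pi.inf_apply, inf_inf_distrib_left, hf, hg,
      ← inf_inf_distrib_left]
  | sup _ _ hf hg => rw [Pi.sup_apply, Pi.sup_apply, inf_sup_left, hf, hg, ← inf_sup_left]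
  | himp _ _ hf hg => rw [Pi.himp_apply, Pi.himp_apply, inf_himp_eq_inf_himp_inf_inf, hf, hg,
      ← inf_himp_eq_inf_himp_inf_inf]
end

section
/- Let H be a Heyting algebra, a ∈ H, and let H⟨ι⟩ ⊆ H^{D_a(H)} be the subalgebra generated by the constant functions and the inclusion ι : D_a(H) ↪ H. If δ ∈ H⟨ι⟩ satisfies a ≤ δ(d) and δ(d) ⇨ a = a for all d ∈ D_a(H) (i.e. δ is dense over the constant function a in H⟨ι⟩), then δ(1) ≤ δ(δ(1)), where 1 is the top element of H. -/
theorem inf_himp_congr_of_inf_eq {H : Type*} [HeytingAlgebra H] {c x x' y y' : H}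
    (hx : c ⊓ x = c ⊓ x') (hy : c ⊓ y = c ⊓ y') : c ⊓ (x ⇨ y) = c ⊓ (x' ⇨ y') := by
  have key : ∀ {x x' y y' : H}, c ⊓ x = c ⊓ x' → c ⊓ y = c ⊓ y' →
      c ⊓ (x ⇨ y) ≤ c ⊓ (x' ⇨ y') := by
    intro x x' y y' hx hy
    refine le_inf inf_le_left (le_himp_iff.2 ?_)
    calc c ⊓ (x ⇨ y) ⊓ x' = (x ⇨ y) ⊓ (c ⊓ x') := by ac_rfl
      _ = c ⊓ ((x ⇨ y) ⊓ x) := by rw [← hx]; ac_rfl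
      _ ≤ c ⊓ y := inf_le_inf_left c himp_inf_le
      _ = c ⊓ y' := hy
      _ ≤ y' := inf_le_right
  exact le_antisymm (key hx hy) (key hx.symm hy.symm)

/-- Heyting polynomials are compatible with the congruence identifying `d` with `⊤`. -/
theorem HIota.inf_apply_eq_inf_apply_top {H : Type*} [HeytingAlgebra H] {a : H}
    {f : {d : H // a ≤ d ∧ d ⇨ a = a} → H} (hf : HIota a f)
    (d : {d : H // a ≤ d ∧ d ⇨ a = a}) :
    d.val ⊓ f d = d.val ⊓ f ⟨⊤, le_top, top_himp⟩ := by
  induction hf with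
  | iota => simp
  | const c => rfl
  | inf _ _ ihf ihg => simp only [Pi.inf_apply, inf_inf_distrib_left d.val, ihf, ihg]
  | sup _ _ ihf ihg => simp only [Pi.sup_apply, inf_sup_left, ihf, ihg]
  | himp _ _ ihf ihg => exact inf_himp_congr_of_inf_eq ihf ihg

/-- If `δ ∈ H⟨ι⟩` is dense over the constant function `a` (pointwise), then
`δ 1 ≤ δ (δ 1)`. -/
theorem stmt_12 {H : Type*} [HeytingAlgebra H] (a : H)
    (δ : {d : H // a ≤ d ∧ d ⇨ a = a} → H) (hδgen : HIota a δ)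
    (hδ : ∀ d : {d : H // a ≤ d ∧ d ⇨ a = a}, a ≤ δ d ∧ δ d ⇨ a = a) :
    δ ⟨⊤, le_top, top_himp⟩ ≤ δ ⟨δ ⟨⊤, le_top, top_himp⟩, hδ ⟨⊤, le_top, top_himp⟩⟩ := by
  have h := hδgen.inf_apply_eq_inf_apply_top
    ⟨δ ⟨⊤, le_top, top_himp⟩, hδ ⟨⊤, le_top, top_himp⟩⟩
  exact inf_eq_left.1 (h.trans (inf_idem _))
end

section
/- Let H be a Heyting algebra, a ∈ H, and let H⟨ι⟩ ⊆ H^{D_a(H)} be the subalgebra generated by the constant functions and the inclusion ι : D_a(H) ↪ H. Suppose δ ∈ H⟨ι⟩ satisfies a ≤ δ(d) and δ(d) ⇨ a = a for all d ∈ D_a(H), and suppose h ∈ H satisfies ι ⇨ δ ≤ const h (pointwise, i.e. d ⇨ δ(d) ≤ h for all d ∈ D_a(H)). Then h = 1. -/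
/-- Below `d`, a function in `H⟨ι⟩` takes the same value at `d` as at any `e ≥ d`. -/
theorem HIota.inf_apply_eq {H : Type*} [HeytingAlgebra H] {a : H}
    {f : {d : H // a ≤ d ∧ d ⇨ a = a} → H} (hf : HIota a f)
    {d e : {d : H // a ≤ d ∧ d ⇨ a = a}} (hde : d.val ≤ e.val) :
    d.val ⊓ f d = d.val ⊓ f e := by
  induction hf with
  | iota => rw [inf_idem, inf_eq_left.mpr hde]
  | const c => rfl
  | inf _ _ hf hg =>
    simp only [Pi.inf_apply]
    rw [inf_inf_distrib_left, hf, hg, ← inf_inf_distrib_left]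
  | sup _ _ hf hg =>
    simp only [Pi.sup_apply]
    rw [inf_sup_left, hf, hg, ← inf_sup_left]
  | @himp f g _ _ hf hg =>
    have inf_himp (x y z : H) : x ⊓ (y ⇨ z) = x ⊓ (x ⊓ y ⇨ x ⊓ z) := by
      apply le_antisymm
      · refine le_inf inf_le_left (le_himp_iff.mpr (le_inf (inf_le_left.trans inf_le_left) ?_))
        calc x ⊓ (y ⇨ z) ⊓ (x ⊓ y) ≤ (y ⇨ z) ⊓ y := inf_le_inf inf_le_right inf_le_right
          _ ≤ z := himp_inf_le
      · refine le_inf inf_le_left (le_himp_iff.mpr ?_)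
        calc x ⊓ (x ⊓ y ⇨ x ⊓ z) ⊓ y = (x ⊓ y ⇨ x ⊓ z) ⊓ (x ⊓ y) := by ac_rfl
          _ ≤ x ⊓ z := himp_inf_le
          _ ≤ z := inf_le_right
    simp only [Pi.himp_apply]
    rw [inf_himp, hf, hg, ← inf_himp]

/-- If `δ ∈ H⟨ι⟩` is dense over the constant function `a` and `h ∈ H` satisfies
`d ⇨ δ d ≤ h` for all `d ∈ D_a(H)`, then `h = ⊤`. -/
theorem stmt_13 {H : Type*} [HeytingAlgebra H] (a : H)
    (δ : {d : H // a ≤ d ∧ d ⇨ a = a} → H) (hδgen : HIota a δ)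
    (hδ : ∀ d : {d : H // a ≤ d ∧ d ⇨ a = a}, a ≤ δ d ∧ δ d ⇨ a = a)
    (h : H) (hle : ∀ d : {d : H // a ≤ d ∧ d ⇨ a = a}, d.val ⇨ δ d ≤ h) :
    h = ⊤ := by
  let t : {d : H // a ≤ d ∧ d ⇨ a = a} := ⟨⊤, le_top, top_himp⟩
  let d : {d : H // a ≤ d ∧ d ⇨ a = a} := ⟨δ t, hδ t⟩
  have key : d.val ⊓ δ d = d.val ⊓ δ t := hδgen.inf_apply_eq le_top
  have hd : d.val ≤ δ d := inf_eq_left.mp (key.trans (inf_idem (δ t)))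
  exact top_le_iff.mp ((himp_eq_top_iff.mpr hd).ge.trans (hle d))
end

section
/- Let H be a Heyting algebra, a ∈ H, and let H⟨ι⟩ ⊆ H^{D_a(H)} be the subalgebra generated by the constant functions and the inclusion ι : D_a(H) ↪ H. Then for every η ∈ H⟨ι⟩, one has ι ⇨ η = ι ⇨ const(η(1)) in H^{D_a(H)}; that is, d ⇨ η(d) = d ⇨ η(1) for all d ∈ D_a(H), where 1 is the top element of H. -/
theorem inf_himp_eq_of_inf_eq {H : Type*} [HeytingAlgebra H] {d x x' y y' : H}
    (hx : d ⊓ x = d ⊓ x') (hy : d ⊓ y = d ⊓ y') : d ⊓ (x ⇨ y) = d ⊓ (x' ⇨ y') := by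
  have key {u u' v v' : H} (hu : d ⊓ u = d ⊓ u') (hv : d ⊓ v = d ⊓ v') :
      d ⊓ (u ⇨ v) ≤ u' ⇨ v' := by
    rw [le_himp_iff]
    calc d ⊓ (u ⇨ v) ⊓ u' = d ⊓ u' ⊓ (u ⇨ v) := inf_right_comm _ _ _
      _ = d ⊓ (u ⊓ (u ⇨ v)) := by rw [← hu, inf_assoc]
      _ ≤ d ⊓ v := inf_le_inf_left d inf_himp_le
      _ ≤ v' := hv ▸ inf_le_right
  exact le_antisymm (le_inf inf_le_left (key hx hy)) (le_inf inf_le_left (key hx.symm hy.symm))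

theorem HIota.inf_apply_eq_s14 {H : Type*} [HeytingAlgebra H] {a : H}
    {η : {d : H // a ≤ d ∧ d ⇨ a = a} → H} (hη : HIota a η)
    (d : {d : H // a ≤ d ∧ d ⇨ a = a}) :
    d.val ⊓ η d = d.val ⊓ η ⟨⊤, le_top, top_himp⟩ := by
  induction hη with
  | iota => simp
  | const c => rfl
  | inf _ _ hf hg => rw [Pi.inf_apply, Pi.inf_apply, inf_inf_distrib_left, hf, hg, ← inf_inf_distrib_left]
  | sup _ _ hf hg => simp only [Pi.sup_apply, inf_sup_left, hf, hg]
  | himp _ _ hf hg => exact inf_himp_eq_of_inf_eq hf hg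

/-- For every `η ∈ H⟨ι⟩`, `ι ⇨ η = ι ⇨ const (η 1)` pointwise:
`d ⇨ η d = d ⇨ η 1` for all `d ∈ D_a(H)`. -/
theorem stmt_14 {H : Type*} [HeytingAlgebra H] (a : H)
    (η : {d : H // a ≤ d ∧ d ⇨ a = a} → H) (hη : HIota a η)
    (d : {d : H // a ≤ d ∧ d ⇨ a = a}) :
    d.val ⇨ η d = d.val ⇨ η ⟨⊤, le_top, top_himp⟩ := by
  have h := congrArg (d.val ⇨ ·) (hη.inf_apply_eq_s14 d)
  simpa only [himp_inf_distrib, himp_self, top_inf_eq] using h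
end

section
/- Let H be a Heyting algebra, a ∈ H, and let H⟨ι⟩ ⊆ H^{D_a(H)} be the subalgebra generated by the constant functions and the inclusion ι : D_a(H) ↪ H. For η ∈ H⟨ι⟩, the following are equivalent: (1) there exists δ ∈ H⟨ι⟩ with a ≤ δ(d) and δ(d) ⇨ a = a for all d ∈ D_a(H), such that ι ⇨ δ ≤ (const a ⇨ η) ⊓ ((η ⇨ const a) ⇨ const a) pointwise; (2) a ≤ η(d) and η(d) ⇨ a = a for all d ∈ D_a(H). -/
/-- For `η ∈ H⟨ι⟩`, the class of `η` is dense over the class of `a` in the quotient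
`H⟨ι⟩/F_a` (expressed by condition (1)) iff `η` is itself pointwise dense over `a`. -/
theorem stmt_15 {H : Type*} [HeytingAlgebra H] (a : H)
    (η : {d : H // a ≤ d ∧ d ⇨ a = a} → H) (hη : HIota a η) :
    (∃ δ : {d : H // a ≤ d ∧ d ⇨ a = a} → H, HIota a δ ∧
      (∀ d : {d : H // a ≤ d ∧ d ⇨ a = a}, a ≤ δ d ∧ δ d ⇨ a = a) ∧
      (∀ d : {d : H // a ≤ d ∧ d ⇨ a = a},
        d.val ⇨ δ d ≤ (a ⇨ η d) ⊓ ((η d ⇨ a) ⇨ a))) ↔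
    (∀ d : {d : H // a ≤ d ∧ d ⇨ a = a}, a ≤ η d ∧ η d ⇨ a = a) := by
  constructor
  · rintro ⟨δ, -, hδ, h⟩ d
    have hle := le_himp.trans (h d)
    refine ⟨?_, le_antisymm ?_ le_himp⟩
    · simpa using (hδ d).1.trans (hle.trans inf_le_left)
    · calc η d ⇨ a ≤ δ d ⇨ a := le_himp_comm.mp (hle.trans inf_le_right)
        _ = a := (hδ d).2
  · intro h
    refine ⟨η, hη, h, fun d => ?_⟩
    simp [(h d).2, himp_eq_top_iff.mpr (h d).1]
end

section
/- Let H be a Heyting algebra, a, b, c ∈ H with c the least element of D_b(H), and let H⟨ι⟩ ⊆ H^{D_a(H)} be the subalgebra generated by the constant functions and the inclusion ι : D_a(H) ↪ H. If η, δ ∈ H⟨ι⟩ are such that δ is dense over const a in H⟨ι⟩ (i.e. a ≤ δ(d) and δ(d) ⇨ a = a for all d ∈ D_a(H)) and ι ⇨ δ ≤ (const b ⇨ η) ⊓ ((η ⇨ const b) ⇨ const b) pointwise, then ι ⇨ δ ≤ const c ⇨ η pointwise. -/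
/-- The join of `x`, `b` and the relative pseudocomplement `x ⇨ b` is dense over `b`. -/
theorem sup_sup_himp_himp_self {H : Type*} [HeytingAlgebra H] (x b : H) :
    (x ⊔ b ⊔ (x ⇨ b)) ⇨ b = b := by
  refine le_antisymm ?_ le_himp
  rw [sup_himp_distrib, sup_himp_distrib, himp_self, inf_top_eq]
  exact inf_himp_le

/-- If `c` is the least element dense over `b`, then every `u` below both `b ⇨ x` and
`(x ⇨ b) ⇨ b` is below `c ⇨ x`. -/
theorem le_himp_of_isLeast_dense {H : Type*} [HeytingAlgebra H] {b c u x : H}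
    (hc : IsLeast {d : H | b ≤ d ∧ d ⇨ b = b} c)
    (hu : u ≤ (b ⇨ x) ⊓ ((x ⇨ b) ⇨ b)) : u ≤ c ⇨ x := by
  obtain ⟨hub, hux⟩ := le_inf_iff.mp hu
  rw [le_himp_iff] at hub hux ⊢
  have hcx : c ≤ x ⊔ b ⊔ (x ⇨ b) :=
    hc.2 ⟨le_sup_of_le_left le_sup_right, sup_sup_himp_himp_self x b⟩
  calc u ⊓ c ≤ u ⊓ (x ⊔ b ⊔ (x ⇨ b)) := inf_le_inf_left u hcx
    _ = u ⊓ x ⊔ u ⊓ b ⊔ u ⊓ (x ⇨ b) := by rw [inf_sup_left, inf_sup_left]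
    _ ≤ x := sup_le (sup_le inf_le_right hub) ((le_inf inf_le_left hux).trans hub)

/-- Let `c` be the least element of `D_b(H)`. If `η, δ ∈ H⟨ι⟩`, `δ` is pointwise
dense over `a`, and `ι ⇨ δ ≤ (const b ⇨ η) ⊓ ((η ⇨ const b) ⇨ const b)` pointwise,
then `ι ⇨ δ ≤ const c ⇨ η` pointwise. -/
theorem stmt_16 {H : Type*} [HeytingAlgebra H] (a b c : H)
    (hc : IsLeast {d : H | b ≤ d ∧ d ⇨ b = b} c)
    (η δ : {d : H // a ≤ d ∧ d ⇨ a = a} → H) (hη : HIota a η) (hδgen : HIota a δ)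
    (hδ : ∀ d : {d : H // a ≤ d ∧ d ⇨ a = a}, a ≤ δ d ∧ δ d ⇨ a = a)
    (hle : ∀ d : {d : H // a ≤ d ∧ d ⇨ a = a},
      d.val ⇨ δ d ≤ (b ⇨ η d) ⊓ ((η d ⇨ b) ⇨ b)) :
    ∀ d : {d : H // a ≤ d ∧ d ⇨ a = a}, d.val ⇨ δ d ≤ c ⇨ η d := by
  intro d
  exact le_himp_of_isLeast_dense hc (hle d)
end

section
/- Let H be a Heyting algebra, a ∈ H, and let H⟨i⟩ be the smallest subset of the function algebra H → H (pointwise Heyting operations) containing the identity function and all constant functions and closed under pointwise ⊓, ⊔, ⇨. Then for every η ∈ H⟨i⟩, the following are equivalent: (1) η(d) = 1 for every d ∈ D_a(H); (2) (h ⇨ a) ⇨ h ≤ η(h) for every h ∈ H. -/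
/-- `H⟨i⟩`: the smallest subset of the function algebra `H → H` (pointwise Heyting
operations) containing the identity function and all constant functions and closed
under pointwise `⊓`, `⊔`, `⇨`. -/
inductive HeytingGen (H : Type*) [HeytingAlgebra H] : (H → H) → Prop
  | id : HeytingGen H id
  | const (c : H) : HeytingGen H (Function.const H c)
  | inf {f g : H → H} : HeytingGen H f → HeytingGen H g → HeytingGen H (f ⊓ g)
  | sup {f g : H → H} : HeytingGen H f → HeytingGen H g → HeytingGen H (f ⊔ g)
  | himp {f g : H → H} : HeytingGen H f → HeytingGen H g → HeytingGen H (f ⇨ g)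

/-- In a Heyting algebra, meeting with `u` only sees the arguments of `⇨` up to meeting with `u`. -/
theorem inf_himp_congr {H : Type*} [HeytingAlgebra H] {u p p' q q' : H}
    (hp : u ⊓ p = u ⊓ p') (hq : u ⊓ q = u ⊓ q') : u ⊓ (p ⇨ q) = u ⊓ (p' ⇨ q') := by
  have key {p p' q q' : H} (hp : u ⊓ p = u ⊓ p') (hq : u ⊓ q = u ⊓ q') :
      u ⊓ (p ⇨ q) ≤ p' ⇨ q' := by
    rw [le_himp_iff]
    calc u ⊓ (p ⇨ q) ⊓ p' = u ⊓ p' ⊓ (p ⇨ q) := inf_right_comm ..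
      _ = u ⊓ (p ⊓ (p ⇨ q)) := by rw [← hp, inf_assoc]
      _ ≤ u ⊓ q := inf_le_inf_left u inf_himp_le
      _ = u ⊓ q' := hq
      _ ≤ q' := inf_le_right
  exact le_antisymm (le_inf inf_le_left (key hp hq)) (le_inf inf_le_left (key hp.symm hq.symm))

/-- Elements of `H⟨i⟩` are compatible with the congruences of `H` induced by meeting with `u`. -/
theorem HeytingGen.inf_congr {H : Type*} [HeytingAlgebra H] {η : H → H} (hη : HeytingGen H η)
    {u x y : H} (h : u ⊓ x = u ⊓ y) : u ⊓ η x = u ⊓ η y := by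
  induction hη with
  | id => exact h
  | const c => rfl
  | inf _ _ hf hg => simp only [Pi.inf_apply, inf_inf_distrib_left u, hf, hg]
  | sup _ _ hf hg => simp only [Pi.sup_apply, inf_sup_left, hf, hg]
  | himp _ _ hf hg => exact inf_himp_congr hf hg

/-- The element `((h ⇨ a) ⇨ h) ⇨ h` is dense over `a`. -/
theorem himp_himp_himp_dense {H : Type*} [HeytingAlgebra H] (a h : H) :
    a ≤ ((h ⇨ a) ⇨ h) ⇨ h ∧ (((h ⇨ a) ⇨ h) ⇨ h) ⇨ a = a := by
  have ha : h ⇨ a ≤ ((h ⇨ a) ⇨ h) ⇨ h := le_himp_iff.2 inf_himp_le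
  refine ⟨le_himp.trans ha, le_antisymm ?_ le_himp⟩
  calc (((h ⇨ a) ⇨ h) ⇨ h) ⇨ a
      ≤ (((h ⇨ a) ⇨ h) ⇨ h) ⊓ ((((h ⇨ a) ⇨ h) ⇨ h) ⇨ a) :=
        le_inf ((himp_le_himp_right le_himp).trans ha) le_rfl
    _ ≤ a := inf_himp_le

/-- For `η ∈ H⟨i⟩`: `η d = ⊤` for every `d` dense over `a` iff
`(h ⇨ a) ⇨ h ≤ η h` for every `h ∈ H`. -/
theorem stmt_17 {H : Type*} [HeytingAlgebra H] (a : H)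
    (η : H → H) (hη : HeytingGen H η) :
    (∀ d : H, a ≤ d ∧ d ⇨ a = a → η d = ⊤) ↔
      (∀ h : H, (h ⇨ a) ⇨ h ≤ η h) := by
  constructor
  · intro H1 h
    have hc := hη.inf_congr (u := (h ⇨ a) ⇨ h) (inf_himp ((h ⇨ a) ⇨ h) h)
    rw [H1 _ (himp_himp_himp_dense a h), inf_top_eq] at hc
    exact inf_eq_left.1 hc.symm
  · rintro H2 d ⟨had, hd⟩
    have := H2 d
    rwa [hd, himp_eq_top_iff.2 had, top_le_iff] at this
end

section
/- For every Heyting algebra H and every a ∈ H there exist a set D, a Heyting algebra K, a subset S of the product Heyting algebra H^D that contains all constant functions and is closed under the pointwise operations ⊓, ⊔, ⇨ (hence is a Heyting algebra), and a surjective Heyting algebra homomorphism π : S → K such that, writing e : H → K for the composite of the diagonal embedding h ↦ const h with π: (a) the set D_{e(a)}(K) has a least element; (b) e is injective; (c) for every b ∈ H, if D_b(H) has a least element then D_{e(b)}(K) has a least element. -/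
section DenseOver

variable {H : Type*} [HeytingAlgebra H]

/-- The set of elements of a Heyting algebra that are dense over `a`. -/
def denseOver (a : H) : Set H :=
  {d | a ≤ d ∧ d ⇨ a = a}

theorem top_mem_denseOver (a : H) : ⊤ ∈ denseOver a :=
  ⟨le_top, top_himp⟩

theorem inf_mem_denseOver {a d e : H} (hd : d ∈ denseOver a) (he : e ∈ denseOver a) :
    d ⊓ e ∈ denseOver a :=
  ⟨le_inf hd.1 he.1, by rw [← himp_himp, he.2, hd.2]⟩

theorem mem_denseOver_of_le {a d e : H} (hd : d ∈ denseOver a) (hde : d ≤ e) :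
    e ∈ denseOver a :=
  ⟨hd.1.trans hde, le_antisymm ((himp_le_himp_right hde).trans_eq hd.2) le_himp⟩

instance nonempty_denseOver (a : H) : Nonempty (denseOver a) :=
  ⟨⟨⊤, top_mem_denseOver a⟩⟩

instance isCodirectedOrder_denseOver (a : H) : IsCodirectedOrder (denseOver a) :=
  ⟨fun d e => ⟨⟨d ⊓ e, inf_mem_denseOver d.2 e.2⟩, inf_le_left, inf_le_right⟩⟩

theorem himp_inf_eq_inf_himp_inf (x y d : H) : (x ⇨ y) ⊓ d = (x ⊓ d ⇨ y ⊓ d) ⊓ d := by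
  refine le_antisymm (le_inf ?_ inf_le_right) (le_inf ?_ inf_le_right) <;> rw [le_himp_iff]
  · refine le_inf ?_ (inf_le_right.trans inf_le_right)
    calc (x ⇨ y) ⊓ d ⊓ (x ⊓ d) ≤ (x ⇨ y) ⊓ x := inf_le_inf inf_le_left inf_le_left
      _ ≤ y := himp_inf_le
  · calc (x ⊓ d ⇨ y ⊓ d) ⊓ d ⊓ x = (x ⊓ d ⇨ y ⊓ d) ⊓ (x ⊓ d) := by
          rw [inf_assoc, inf_comm d x]
      _ ≤ y ⊓ d := himp_inf_le
      _ ≤ y := inf_le_left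

/-- The functions on `denseOver a` that agree with a single element `c` modulo every
principal filter generated by the argument. Heyting polynomials have this property, with `c`
their value at `⊤`. -/
def polynomialLike (a : H) : Set (denseOver a → H) :=
  {f | ∃ c : H, ∀ d : denseOver a, f d ⊓ d = c ⊓ d}

variable {a : H} {f g : denseOver a → H}

theorem const_mem_polynomialLike (a h : H) :
    Function.const (denseOver a) h ∈ polynomialLike a :=
  ⟨h, fun _ => rfl⟩

theorem coe_mem_polynomialLike (a : H) : (fun d : denseOver a => (d : H)) ∈ polynomialLike a :=
  ⟨⊤, fun d => by simp⟩

theorem inf_mem_polynomialLike (hf : f ∈ polynomialLike a) (hg : g ∈ polynomialLike a) :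
    f ⊓ g ∈ polynomialLike a := by
  obtain ⟨c, hc⟩ := hf
  obtain ⟨e, he⟩ := hg
  exact ⟨c ⊓ e, fun d => by rw [Pi.inf_apply, inf_inf_distrib_right, hc, he,
    ← inf_inf_distrib_right]⟩

theorem sup_mem_polynomialLike (hf : f ∈ polynomialLike a) (hg : g ∈ polynomialLike a) :
    f ⊔ g ∈ polynomialLike a := by
  obtain ⟨c, hc⟩ := hf
  obtain ⟨e, he⟩ := hg
  exact ⟨c ⊔ e, fun d => by rw [Pi.sup_apply, inf_sup_right, hc, he, ← inf_sup_right]⟩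

theorem himp_mem_polynomialLike (hf : f ∈ polynomialLike a) (hg : g ∈ polynomialLike a) :
    f ⇨ g ∈ polynomialLike a := by
  obtain ⟨c, hc⟩ := hf
  obtain ⟨e, he⟩ := hg
  exact ⟨c ⇨ e, fun d => by rw [Pi.himp_apply, himp_inf_eq_inf_himp_inf, hc, he,
    ← himp_inf_eq_inf_himp_inf]⟩

/-- A polynomial-like function whose values are eventually dense over `a` eventually dominates
its argument. -/
theorem eventually_le_of_mem_polynomialLike (hf : f ∈ polynomialLike a)
    (h : ∀ᶠ d in Filter.atBot, f d ∈ denseOver a) :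
    ∀ᶠ d : denseOver a in Filter.atBot, (d : H) ≤ f d := by
  obtain ⟨c, hc⟩ := hf
  obtain ⟨d, hd⟩ := h.exists
  have hcd : c ∈ denseOver a :=
    mem_denseOver_of_le (inf_mem_denseOver hd d.2) ((hc d).trans_le inf_le_left)
  filter_upwards [Filter.eventually_le_atBot (⟨c, hcd⟩ : denseOver a)] with e hec
  have hec' : (e : H) ≤ c := hec
  rw [← inf_eq_right, hc, inf_eq_right.2 hec']

end DenseOver

namespace Filter.Germ

variable {α β : Type*} {l : Filter α} [HeytingAlgebra β]

instance instHeytingAlgebra : HeytingAlgebra (Germ l β) :=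
  HeytingAlgebra.ofHImp (map₂ (· ⇨ ·)) fun x y z =>
    inductionOn₃ x y z fun _ _ _ => eventually_congr (.of_forall fun _ => le_himp_iff)

theorem mem_denseOver_iff {b : β} {f : α → β} :
    (f : Germ l β) ∈ denseOver ((Function.const α b : α → β) : Germ l β) ↔
      ∀ᶠ d in l, f d ∈ denseOver b :=
  (and_congr Iff.rfl coe_eq).trans eventually_and.symm

end Filter.Germ

/-- The image in the germs along `Filter.atBot` of the polynomial-like functions. -/
def PolynomialGerm {H : Type*} [HeytingAlgebra H] (a : H) : Type _ :=
  {x : Filter.Germ (Filter.atBot : Filter (denseOver a)) H //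
    ∃ f ∈ polynomialLike a, (f : Filter.Germ (Filter.atBot : Filter (denseOver a)) H) = x}

namespace PolynomialGerm

variable {H : Type*} [HeytingAlgebra H] {a : H}

/-- The germ of a polynomial-like function. -/
def mk (f : polynomialLike a) : PolynomialGerm a :=
  ⟨(f : denseOver a → H), f, f.2, rfl⟩

theorem mk_surjective : Function.Surjective (mk : polynomialLike a → PolynomialGerm a) := by
  rintro ⟨_, f, hf, rfl⟩
  exact ⟨⟨f, hf⟩, rfl⟩

instance : HeytingAlgebra (PolynomialGerm a) :=
  letI : Max (PolynomialGerm a) := ⟨fun x y => ⟨x.1 ⊔ y.1, by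
    obtain ⟨_, f, hf, rfl⟩ := x
    obtain ⟨_, g, hg, rfl⟩ := y
    exact ⟨f ⊔ g, sup_mem_polynomialLike hf hg, rfl⟩⟩⟩
  letI : Min (PolynomialGerm a) := ⟨fun x y => ⟨x.1 ⊓ y.1, by
    obtain ⟨_, f, hf, rfl⟩ := x
    obtain ⟨_, g, hg, rfl⟩ := y
    exact ⟨f ⊓ g, inf_mem_polynomialLike hf hg, rfl⟩⟩⟩
  letI : HImp (PolynomialGerm a) := ⟨fun x y => ⟨x.1 ⇨ y.1, by
    obtain ⟨_, f, hf, rfl⟩ := x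
    obtain ⟨_, g, hg, rfl⟩ := y
    exact ⟨f ⇨ g, himp_mem_polynomialLike hf hg, rfl⟩⟩⟩
  letI : Top (PolynomialGerm a) := ⟨mk ⟨_, const_mem_polynomialLike a ⊤⟩⟩
  letI : Bot (PolynomialGerm a) := ⟨mk ⟨_, const_mem_polynomialLike a ⊥⟩⟩
  letI : Compl (PolynomialGerm a) := ⟨fun x => x ⇨ ⊥⟩
  letI : LE (PolynomialGerm a) := ⟨fun x y => x.1 ≤ y.1⟩
  letI : LT (PolynomialGerm a) := ⟨fun x y => x.1 < y.1⟩
  Function.Injective.heytingAlgebra Subtype.val Subtype.val_injective Iff.rfl Iff.rfl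
    (fun _ _ => rfl) (fun _ _ => rfl) rfl rfl (fun x => himp_bot x.1) fun _ _ => rfl

theorem mk_le_mk {f g : polynomialLike a} :
    mk f ≤ mk g ↔ ∀ᶠ d in Filter.atBot, (f : denseOver a → H) d ≤ (g : denseOver a → H) d :=
  Iff.rfl

theorem mk_mem_denseOver_iff {b : H} {f : polynomialLike a} :
    mk f ∈ denseOver (mk ⟨_, const_mem_polynomialLike a b⟩) ↔
      ∀ᶠ d in Filter.atBot, (f : denseOver a → H) d ∈ denseOver b :=
  (and_congr Iff.rfl Subtype.ext_iff).trans Filter.Germ.mem_denseOver_iff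

theorem isLeast_denseOver_mk_coe (a : H) :
    IsLeast (denseOver (mk ⟨_, const_mem_polynomialLike a a⟩))
      (mk ⟨_, coe_mem_polynomialLike a⟩) := by
  refine ⟨mk_mem_denseOver_iff.2 (.of_forall Subtype.property), fun x hx => ?_⟩
  obtain ⟨f, rfl⟩ := mk_surjective x
  exact mk_le_mk.2 (eventually_le_of_mem_polynomialLike f.2 (mk_mem_denseOver_iff.1 hx))

theorem isLeast_denseOver_mk_const {b m : H} (hm : IsLeast (denseOver b) m) :
    IsLeast (denseOver (mk ⟨_, const_mem_polynomialLike a b⟩))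
      (mk ⟨_, const_mem_polynomialLike a m⟩) := by
  refine ⟨mk_mem_denseOver_iff.2 (.of_forall fun _ => hm.1), fun x hx => ?_⟩
  obtain ⟨f, rfl⟩ := mk_surjective x
  exact mk_le_mk.2 ((mk_mem_denseOver_iff.1 hx).mono fun _ hd => hm.2 hd)

theorem mk_const_injective :
    Function.Injective fun h : H => mk ⟨_, const_mem_polynomialLike a h⟩ := fun _ _ h =>
  Filter.Germ.const_inj.1 (congrArg Subtype.val h)

end PolynomialGerm

/-- The one-step enrichment: for every Heyting algebra `H` and `a ∈ H` there are a
set `D`, a Heyting algebra `K`, a subalgebra `S` of the product `H^D` containing all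
constant functions, and a surjective Heyting homomorphism `π : S → K` (encoded via
its action on the subtype, preserving all operations) such that, with
`e h = π (const h)`: (a) `D_{e a}(K)` has a least element; (b) `e` is injective;
(c) for every `b ∈ H`, if `D_b(H)` has a least element then so does `D_{e b}(K)`. -/
theorem stmt_18 {H : Type u} [HeytingAlgebra H] (a : H) :
    ∃ (D : Type u) (K : Type u) (_ : HeytingAlgebra K) (S : Set (D → H))
      (hconst : ∀ h : H, Function.const D h ∈ S)
      (_ : ∀ f g : D → H, f ∈ S → g ∈ S → f ⊓ g ∈ S)
      (_ : ∀ f g : D → H, f ∈ S → g ∈ S → f ⊔ g ∈ S)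
      (_ : ∀ f g : D → H, f ∈ S → g ∈ S → f ⇨ g ∈ S)
      (π : S → K),
      Function.Surjective π ∧
      (∀ (x y : S) (hxy : (x : D → H) ⊓ (y : D → H) ∈ S),
        π ⟨(x : D → H) ⊓ (y : D → H), hxy⟩ = π x ⊓ π y) ∧
      (∀ (x y : S) (hxy : (x : D → H) ⊔ (y : D → H) ∈ S),
        π ⟨(x : D → H) ⊔ (y : D → H), hxy⟩ = π x ⊔ π y) ∧
      (∀ (x y : S) (hxy : (x : D → H) ⇨ (y : D → H) ∈ S),
        π ⟨(x : D → H) ⇨ (y : D → H), hxy⟩ = π x ⇨ π y) ∧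
      π ⟨Function.const D ⊥, hconst ⊥⟩ = ⊥ ∧
      π ⟨Function.const D ⊤, hconst ⊤⟩ = ⊤ ∧
      (∃ m, IsLeast {d : K | π ⟨Function.const D a, hconst a⟩ ≤ d ∧
        d ⇨ π ⟨Function.const D a, hconst a⟩ = π ⟨Function.const D a, hconst a⟩} m) ∧
      Function.Injective (fun h : H => π ⟨Function.const D h, hconst h⟩) ∧
      (∀ b : H, (∃ m, IsLeast {d : H | b ≤ d ∧ d ⇨ b = b} m) →
        ∃ m, IsLeast {d : K | π ⟨Function.const D b, hconst b⟩ ≤ d ∧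
          d ⇨ π ⟨Function.const D b, hconst b⟩ = π ⟨Function.const D b, hconst b⟩} m) := by
  exact ⟨denseOver a, PolynomialGerm a, inferInstance, polynomialLike a,
    const_mem_polynomialLike a, fun _ _ => inf_mem_polynomialLike,
    fun _ _ => sup_mem_polynomialLike, fun _ _ => himp_mem_polynomialLike,
    PolynomialGerm.mk, PolynomialGerm.mk_surjective, fun _ _ _ => rfl, fun _ _ _ => rfl,
    fun _ _ _ => rfl, rfl, rfl, ⟨_, PolynomialGerm.isLeast_denseOver_mk_coe a⟩,
    PolynomialGerm.mk_const_injective,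
    fun _ ⟨_, hm⟩ => ⟨_, PolynomialGerm.isLeast_denseOver_mk_const hm⟩⟩
end

section
/- For every Heyting algebra H there exist a Heyting algebra K, an injective Heyting algebra homomorphism f : H → K, and a unary operation Δ : K → K satisfying x ≤ Δx, (Δx) ⇨ x = x, and Δx ≤ y ⊔ (y ⇨ x) for all x, y ∈ K (so that K with Δ is a KM-algebra), such that K lies in the variety of Heyting algebras generated by H; concretely, there exist a set I, a subset S of the product Heyting algebra H^I closed under the pointwise operations ⊓, ⊔, ⇨ and containing the constant functions, and a surjective Heyting algebra homomorphism q : S → K. -/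
namespace KM

/-- Heyting terms with constants from `H` and an extra unary connective `delta`. -/
inductive Term (H : Type u) : Type u
  | const : H → Term H
  | inf : Term H → Term H → Term H
  | sup : Term H → Term H → Term H
  | imp : Term H → Term H → Term H
  | delta : Term H → Term H

/-- The number of connectives of a term. -/
def Term.size {H : Type u} : Term H → ℕ
  | const _ => 0
  | inf s t => s.size + t.size + 1
  | sup s t => s.size + t.size + 1
  | imp s t => s.size + t.size + 1
  | delta t => t.size + 1

/-- The value of a term, where `v t` is the value of the term `delta t`. -/
def Term.eval {H : Type u} [HeytingAlgebra H] (v : Term H → H) : Term H → H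
  | const h => h
  | inf s t => s.eval v ⊓ t.eval v
  | sup s t => s.eval v ⊔ t.eval v
  | imp s t => s.eval v ⇨ t.eval v
  | delta t => v t

theorem Term.eval_congr {H : Type u} [HeytingAlgebra H] {v w : Term H → H} (s : Term H)
    (h : ∀ t, t.size < s.size → v t = w t) : s.eval v = s.eval w := by
  induction s with
  | const => rfl
  | delta t => exact h t (Nat.lt_succ_self _)
  | inf s t hs ht | sup s t hs ht | imp s t hs ht =>
    simp only [eval, size] at h ⊢
    rw [hs fun r hr => h r (by lia), ht fun r hr => h r (by lia)]

section Compatible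

variable {α H : Type*} [HeytingAlgebra H]

/-- A function of a valuation is compatible if it preserves equality modulo every principal
filter of `H`. -/
def Compatible (φ : (α → H) → H) : Prop :=
  ∀ (b : H) (v w : α → H), (∀ a, b ⊓ v a = b ⊓ w a) → b ⊓ φ v = b ⊓ φ w

theorem inf_himp_congr {b x x' y y' : H} (hx : b ⊓ x = b ⊓ x') (hy : b ⊓ y = b ⊓ y') :
    b ⊓ (x ⇨ y) = b ⊓ (x' ⇨ y') := by
  have key : ∀ {x x' y y' : H}, b ⊓ x = b ⊓ x' → b ⊓ y = b ⊓ y' →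
      b ⊓ (x ⇨ y) ≤ b ⊓ (x' ⇨ y') := by
    intro x x' y y' hx hy
    refine le_inf inf_le_left (le_himp_iff.2 ?_)
    calc b ⊓ (x ⇨ y) ⊓ x' = b ⊓ x' ⊓ (x ⇨ y) := inf_right_comm ..
      _ = b ⊓ (x ⊓ (x ⇨ y)) := by rw [← hx, inf_assoc]
      _ ≤ b ⊓ y := inf_le_inf_left b inf_himp_le
      _ = b ⊓ y' := hy
      _ ≤ y' := inf_le_right
  exact le_antisymm (key hx hy) (key hx.symm hy.symm)

namespace Compatible

variable {φ ψ : (α → H) → H}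

theorem sup (hφ : Compatible φ) (hψ : Compatible ψ) : Compatible fun v => φ v ⊔ ψ v := by
  intro b v w h
  simp only [inf_sup_left, hφ b v w h, hψ b v w h]

theorem inf (hφ : Compatible φ) (hψ : Compatible ψ) : Compatible fun v => φ v ⊓ ψ v := by
  intro b v w h
  simp only [inf_inf_distrib_left b, hφ b v w h, hψ b v w h]

theorem himp (hφ : Compatible φ) (hψ : Compatible ψ) : Compatible fun v => φ v ⇨ ψ v :=
  fun b v w h => inf_himp_congr (hφ b v w h) (hψ b v w h)

theorem finsetInf {ι : Type*} (G : Finset ι) {φ : ι → (α → H) → H}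
    (hφ : ∀ i, Compatible (φ i)) : Compatible fun v => G.inf fun i => φ i v := by
  classical
  induction G using Finset.induction_on with
  | empty => exact fun _ _ _ _ => rfl
  | insert i G _ ih =>
    simp only [Finset.inf_insert]
    exact (hφ i).inf ih

theorem update [DecidableEq α] (hφ : Compatible φ) (hψ : Compatible ψ) (a : α) :
    Compatible fun v => φ (Function.update v a (ψ v)) := by
  intro b v w h
  refine hφ b _ _ fun c => ?_
  obtain rfl | hc := eq_or_ne c a
  · simpa using hψ b v w h
  · simpa [hc] using h c

end Compatible

end Compatible

variable {H : Type u} [HeytingAlgebra H]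

theorem Term.compatible_eval (t : Term H) : Compatible fun v => t.eval v := by
  induction t with
  | const => exact fun _ _ _ _ => rfl
  | inf s t hs ht => exact hs.inf ht
  | sup s t hs ht => exact hs.sup ht
  | imp s t hs ht => exact hs.himp ht
  | delta t => exact fun _ _ _ h => h t

/-- Finite meets of elements of the form `y ⊔ (y ⇨ x)` are dense relative to `x`. -/
theorem finsetInf_himp_eq {ι : Type*} (G : Finset ι) (y : ι → H) (x : H) :
    (G.inf fun i => y i ⊔ (y i ⇨ x)) ⇨ x = x := by
  classical
  induction G using Finset.induction_on with
  | empty => simp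
  | insert i G _ ih =>
    have hdense : y i ⊔ (y i ⇨ x) ⇨ x = x := by
      rw [sup_himp_distrib]
      exact le_antisymm inf_himp_le (le_inf le_himp le_himp)
    rw [Finset.inf_insert, ← himp_himp, ih, hdense]

/-- Values for finitely many terms `delta t` can be chosen in `H` so that the KM-laws hold with
respect to finitely many prescribed compatible functions. -/
theorem exists_valuation {ι : Type*} (G : Finset ι) (D : Finset (Term H))
    (φ : ι → (Term H → H) → H) (hφ : ∀ i, Compatible (φ i)) :
    ∃ v : Term H → H, ∀ t ∈ D, t.eval v ≤ v t ∧ v t ⇨ t.eval v = t.eval v ∧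
      ∀ i ∈ G, v t ≤ φ i v ⊔ (φ i v ⇨ t.eval v) := by
  classical
  revert φ
  refine Finset.induction_on_max_value Term.size D ?_ ?_
  · exact fun _ _ => ⟨fun _ => ⊥, by simp⟩
  · intro t D htD hmax ih φ hφ
    let ψ : ι → (Term H → H) → H := fun i v => φ i (Function.update v t ⊤)
    have hψ : ∀ i, Compatible (ψ i) := fun i => (hφ i).update (fun _ _ _ _ => rfl) t
    let β : (Term H → H) → H := fun v => G.inf fun i => ψ i v ⊔ (ψ i v ⇨ t.eval v)
    have hβ : Compatible β :=
      Compatible.finsetInf G fun i => (hψ i).sup ((hψ i).himp t.compatible_eval)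
    obtain ⟨v, hv⟩ := ih (fun i w => φ i (Function.update w t (β w)))
      fun i => (hφ i).update hβ t
    have heval : ∀ s : Term H, s.size ≤ t.size →
        s.eval (Function.update v t (β v)) = s.eval v := by
      refine fun s hs => s.eval_congr fun r hr => Function.update_of_ne ?_ _ _
      rintro rfl
      lia
    refine ⟨Function.update v t (β v), fun s hs => ?_⟩
    obtain rfl | hs := Finset.mem_insert.1 hs
    · rw [heval s le_rfl, Function.update_self]
      refine ⟨Finset.le_inf fun i _ => le_sup_of_le_right le_himp,
        finsetInf_himp_eq G _ _, fun i hi => ?_⟩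
      have hle : β v ≤ ψ i v ⊔ (ψ i v ⇨ s.eval v) := Finset.inf_le hi
      have hagree : β v ⊓ φ i (Function.update v s (β v)) = β v ⊓ ψ i v := by
        refine hφ i _ _ _ fun c => ?_
        obtain rfl | hc := eq_or_ne c s
        · simp
        · simp [hc]
      rw [← inf_eq_left, inf_sup_left, hagree, inf_himp_congr hagree rfl, ← inf_sup_left]
      exact inf_eq_left.2 hle
    · have hne : s ≠ t := fun h => htD (h ▸ hs)
      rw [heval s (hmax s hs), Function.update_of_ne hne]
      exact hv s hs

section Germ

variable {I : Type*} (l : Filter I)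

/-- The Heyting algebra of germs of functions along a filter. -/
instance germHeytingAlgebra : HeytingAlgebra (Filter.Germ l H) where
  himp := Filter.Germ.map₂ (· ⇨ ·)
  compl := Filter.Germ.map compl
  le_top x := Filter.Germ.inductionOn x fun _ => Filter.Eventually.of_forall fun _ => le_top
  bot_le x := Filter.Germ.inductionOn x fun _ => Filter.Eventually.of_forall fun _ => bot_le
  le_himp_iff x y z := Filter.Germ.inductionOn₃ x y z fun _ _ _ =>
    Filter.eventually_congr (Filter.Eventually.of_forall fun _ => le_himp_iff)
  himp_bot x := Filter.Germ.inductionOn x fun _ =>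
    congrArg Filter.Germ.ofFun (funext fun _ => himp_bot _)

end Germ

/-- The germs of the functions that a family of valuations induces by evaluating terms. -/
abbrev TermGerm {I : Type u} (l : Filter I) (v : I → Term H → H) : Type u :=
  {x : Filter.Germ l H // ∃ t : Term H, x = ((fun i => t.eval (v i) : I → H) : Filter.Germ l H)}

namespace TermGerm

variable {I : Type u} (l : Filter I) (v : I → Term H → H)

instance : Max (TermGerm l v) := ⟨fun x y => ⟨x.1 ⊔ y.1, by
  obtain ⟨_, s, rfl⟩ := x
  obtain ⟨_, t, rfl⟩ := y
  exact ⟨s.sup t, rfl⟩⟩⟩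

instance : Min (TermGerm l v) := ⟨fun x y => ⟨x.1 ⊓ y.1, by
  obtain ⟨_, s, rfl⟩ := x
  obtain ⟨_, t, rfl⟩ := y
  exact ⟨s.inf t, rfl⟩⟩⟩

instance : HImp (TermGerm l v) := ⟨fun x y => ⟨x.1 ⇨ y.1, by
  obtain ⟨_, s, rfl⟩ := x
  obtain ⟨_, t, rfl⟩ := y
  exact ⟨s.imp t, rfl⟩⟩⟩

instance : Top (TermGerm l v) := ⟨⟨⊤, .const ⊤, rfl⟩⟩

instance : Bot (TermGerm l v) := ⟨⟨⊥, .const ⊥, rfl⟩⟩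

instance : Compl (TermGerm l v) := ⟨fun x => ⟨x.1ᶜ, by
  rw [← himp_bot]
  exact (x ⇨ ⊥).2⟩⟩

instance : HeytingAlgebra (TermGerm l v) :=
  Subtype.val_injective.heytingAlgebra _ Iff.rfl Iff.rfl (fun _ _ => rfl) (fun _ _ => rfl) rfl rfl
    (fun _ => rfl) fun _ _ => rfl

end TermGerm

end KM

/-- Every Heyting algebra `H` embeds into a KM-algebra `K` lying in the variety of
Heyting algebras generated by `H`: there are an injective Heyting homomorphism
`f : H → K` and an operation `Δ : K → K` satisfying the KM-identities, together with
a set `I`, a subalgebra `S` of the product `H^I` containing the constant functions,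
and a surjective Heyting homomorphism `q : S → K` (encoded via its action on the
subtype, preserving all operations), witnessing that `K` is in the variety of `H`. -/
theorem stmt_19 {H : Type u} [HeytingAlgebra H] :
    ∃ (K : Type u) (_ : HeytingAlgebra K) (f : HeytingHom H K) (Δ : K → K),
      Function.Injective f ∧
      (∀ x : K, x ≤ Δ x) ∧
      (∀ x : K, Δ x ⇨ x = x) ∧
      (∀ x y : K, Δ x ≤ y ⊔ (y ⇨ x)) ∧
      ∃ (I : Type u) (S : Set (I → H))
        (hconst : ∀ h : H, Function.const I h ∈ S)
        (_ : ∀ u v : I → H, u ∈ S → v ∈ S → u ⊓ v ∈ S)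
        (_ : ∀ u v : I → H, u ∈ S → v ∈ S → u ⊔ v ∈ S)
        (_ : ∀ u v : I → H, u ∈ S → v ∈ S → u ⇨ v ∈ S)
        (q : S → K),
        Function.Surjective q ∧
        (∀ (x y : S) (hxy : (x : I → H) ⊓ (y : I → H) ∈ S),
          q ⟨(x : I → H) ⊓ (y : I → H), hxy⟩ = q x ⊓ q y) ∧
        (∀ (x y : S) (hxy : (x : I → H) ⊔ (y : I → H) ∈ S),
          q ⟨(x : I → H) ⊔ (y : I → H), hxy⟩ = q x ⊔ q y) ∧
        (∀ (x y : S) (hxy : (x : I → H) ⇨ (y : I → H) ∈ S),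
          q ⟨(x : I → H) ⇨ (y : I → H), hxy⟩ = q x ⇨ q y) ∧
        q ⟨Function.const I ⊥, hconst ⊥⟩ = ⊥ ∧
        q ⟨Function.const I ⊤, hconst ⊤⟩ = ⊤ := by
  classical
  let I := Finset (KM.Term H)
  choose v hv using fun F : I =>
    KM.exists_valuation F F (fun t w => t.eval w) fun t => t.compatible_eval
  let l : Filter I := Filter.atTop
  have hmem : ∀ t : KM.Term H, ∀ᶠ F in l, t ∈ F := fun t =>
    (Filter.eventually_ge_atTop {t}).mono fun F hF => Finset.singleton_subset_iff.1 hF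
  have hΔ : ∀ x : KM.TermGerm l v, ∃ d : KM.TermGerm l v,
      x ≤ d ∧ d ⇨ x = x ∧ ∀ y, d ≤ y ⊔ (y ⇨ x) := by
    rintro ⟨_, t, rfl⟩
    refine ⟨⟨_, t.delta, rfl⟩, ?_, Subtype.ext ?_, ?_⟩
    · exact (hmem t).mono fun F hF => (hv F t hF).1
    · exact Filter.Germ.coe_eq.2 ((hmem t).mono fun F hF => (hv F t hF).2.1)
    · rintro ⟨_, s, rfl⟩
      exact ((hmem t).and (hmem s)).mono fun F hF => (hv F t hF.1).2.2 s hF.2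
  choose Δ hΔ using hΔ
  refine ⟨KM.TermGerm l v, inferInstance,
    { toFun := fun h => ⟨_, .const h, rfl⟩
      map_sup' := fun _ _ => rfl
      map_inf' := fun _ _ => rfl
      map_bot' := rfl
      map_himp' := fun _ _ => rfl },
    Δ, fun a b hab => Filter.Germ.const_inj.1 (congrArg Subtype.val hab),
    fun x => (hΔ x).1, fun x => (hΔ x).2.1, fun x => (hΔ x).2.2,
    I, {u | ∃ t : KM.Term H, u = fun F => t.eval (v F)}, fun h => ⟨.const h, rfl⟩,
    ?_, ?_, ?_, fun u => ⟨(u.1 : Filter.Germ l H), u.2.imp fun _ => congrArg _⟩,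
    ?_, fun _ _ _ => rfl, fun _ _ _ => rfl, fun _ _ _ => rfl, rfl, rfl⟩
  · rintro _ _ ⟨s, rfl⟩ ⟨t, rfl⟩
    exact ⟨s.inf t, rfl⟩
  · rintro _ _ ⟨s, rfl⟩ ⟨t, rfl⟩
    exact ⟨s.sup t, rfl⟩
  · rintro _ _ ⟨s, rfl⟩ ⟨t, rfl⟩
    exact ⟨s.imp t, rfl⟩
  · rintro ⟨_, t, rfl⟩
    exact ⟨⟨_, t, rfl⟩, rfl⟩
end
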